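/- arXiv:1309.6223 — 4 statements merged into one kernel-verified Lean document; each statement's English description precedes it below -/
import Mathlib

section
/- Let 𝔤 be a nonzero finite-dimensional real Lie algebra equipped with a norm, and let α : ℤ^r → Aut(𝔤) be a group homomorphism into its Lie algebra automorphisms. Then there exist finitely many pairwise distinct linear functionals χ_1, …, χ_m on ℝ^r (the Lyapunov exponents) and nonzero linear subspaces 𝔳^{χ_1}, …, 𝔳^{χ_m} of 𝔤, each invariant under every α(n), such that: (1) 𝔤 = 𝔳^{χ_1} ⊕ ⋯ ⊕ 𝔳^{χ_m}; (2) for every i and every nonzero v ∈ 𝔳^{χ_i}, (log‖α(n)v‖ − χ_i(n))/|n| → 0 as |n| → ∞ with n ∈ ℤ^r; (3) for all i, j: if χ_i + χ_j = χ_k for some k, then the bracket satisfies [𝔳^{χ_i}, 𝔳^{χ_j}] ⊆ 𝔳^{χ_k}, and if χ_i + χ_j is not among χ_1, …, χ_m then [𝔳^{χ_i}, 𝔳^{χ_j}] = 0. -/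
/-!
STATEMENT 8: Let 𝔤 be a nonzero finite-dimensional real Lie algebra equipped with a norm,
and let α : ℤ^r → Aut(𝔤) be a group homomorphism into its Lie algebra automorphisms.  Then
there exist finitely many pairwise distinct linear functionals χ_1, …, χ_m on ℝ^r and
nonzero α-invariant subspaces 𝔳^{χ_i} such that: (1) 𝔤 = ⊕ 𝔳^{χ_i}; (2) for every nonzero
v ∈ 𝔳^{χ_i}, (log‖α(n)v‖ − χ_i(n))/|n| → 0 as |n| → ∞; (3) brackets of Lyapunov subspaces
land in the Lyapunov subspace of the sum of the exponents (and vanish if that sum is not a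
Lyapunov exponent).

The Lie algebra is encoded as a finite-dimensional normed real vector space `L` together
with a bilinear bracket satisfying alternativity and the Jacobi identity, and `α` takes
values in the linear automorphisms of `L` preserving the bracket.
-/

open Filter

noncomputable section

/-- The integer vector `n`, seen in `ℝ^r`. -/
def realVec {r : ℕ} (n : Fin r → ℤ) : Fin r → ℝ := fun j => (n j : ℝ)

lemma realVec_add {r : ℕ} (m n : Fin r → ℤ) : realVec (m + n) = realVec m + realVec n := by
  ext j; simp [realVec]

lemma realVec_neg {r : ℕ} (n : Fin r → ℤ) : realVec (-n) = -realVec n := by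
  ext j; simp [realVec]

lemma realVec_nsmul {r : ℕ} (k : ℕ) (n : Fin r → ℤ) :
    realVec (k • n) = (k : ℝ) • realVec n := by
  ext j; simp [realVec]

section Uniform

variable {𝕜 E : Type*} [RCLike 𝕜] [NormedAddCommGroup E] [NormedSpace 𝕜 E]
  [FiniteDimensional 𝕜 E]

/-- Uniform boundedness for families of linear maps on a subspace of a finite-dimensional space. -/
lemma exists_uniform_bound_of_forall_mem {ι : Type*} (W : Submodule 𝕜 E) (A : ι → Module.End 𝕜 E)
    (g : ι → ℝ) (hg : ∀ i, 0 < g i) (h : ∀ w ∈ W, ∃ C : ℝ, ∀ i, ‖A i w‖ ≤ C * g i) :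
    ∃ C : ℝ, 0 < C ∧ ∀ i, ∀ w ∈ W, ‖A i w‖ ≤ C * g i * ‖w‖ := by
  have : CompleteSpace W := FiniteDimensional.complete 𝕜 W
  have key : ∀ i, ∀ w : E, ‖((((g i)⁻¹ : ℝ) : 𝕜) • A i) w‖ = (g i)⁻¹ * ‖A i w‖ := fun i w => by
    rw [LinearMap.smul_apply, norm_smul, RCLike.norm_ofReal, abs_of_pos (inv_pos.2 (hg i))]
  obtain ⟨C, hC⟩ := banach_steinhaus
    (g := fun i => LinearMap.toContinuousLinearMap (((((g i)⁻¹ : ℝ) : 𝕜) • A i) ∘ₗ W.subtype)) (by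
      rintro ⟨w, hw⟩
      obtain ⟨C, hC⟩ := h w hw
      refine ⟨C, fun i => ?_⟩
      have h1 := key i w
      simp only [LinearMap.coe_toContinuousLinearMap', LinearMap.comp_apply, Submodule.subtype_apply]
      rw [h1, inv_mul_le_iff₀ (hg i), mul_comm]
      exact hC i)
  refine ⟨max C 1, by positivity, fun i w hw => ?_⟩
  have h2 := ContinuousLinearMap.le_of_opNorm_le _ (hC i) ⟨w, hw⟩
  have h1 := key i w
  simp only [LinearMap.coe_toContinuousLinearMap', LinearMap.comp_apply, Submodule.subtype_apply]
    at h2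
  rw [h1, inv_mul_le_iff₀ (hg i)] at h2
  calc ‖A i w‖ ≤ g i * (C * ‖w‖) := h2
    _ ≤ g i * (max C 1 * ‖w‖) := by
        have := (hg i).le
        gcongr
        exact le_max_left _ _
    _ = _ := by ring

end Uniform

section LyapunovSpace

variable {𝕜 E : Type*} [RCLike 𝕜] [NormedAddCommGroup E] [NormedSpace 𝕜 E] {r : ℕ}

/-- The space of vectors whose growth under the family `A` has exponential rate at most `χ`,
up to subexponential error. -/
def lyapunovSpace (A : (Fin r → ℤ) → Module.End 𝕜 E) (χ : (Fin r → ℝ) →ₗ[ℝ] ℝ) :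
    Submodule 𝕜 E where
  carrier := {v | ∀ ε : ℝ, 0 < ε → ∃ C : ℝ, ∀ n,
    ‖A n v‖ ≤ C * Real.exp (χ (realVec n) + ε * ‖realVec n‖)}
  zero_mem' := fun ε _ => ⟨0, fun n => by simp⟩
  add_mem' := by
    intro v w hv hw ε hε
    obtain ⟨C, hC⟩ := hv ε hε
    obtain ⟨D, hD⟩ := hw ε hε
    refine ⟨C + D, fun n => ?_⟩
    rw [map_add, add_mul]
    exact (norm_add_le _ _).trans (add_le_add (hC n) (hD n))
  smul_mem' := by
    intro c v hv ε hε
    obtain ⟨C, hC⟩ := hv ε hε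
    refine ⟨‖c‖ * C, fun n => ?_⟩
    rw [map_smul, norm_smul, mul_assoc]
    exact mul_le_mul_of_nonneg_left (hC n) (norm_nonneg _)

lemma nonneg_of_norm_le_mul_exp {x C t : ℝ} (hx : 0 ≤ x) (h : x ≤ C * Real.exp t) : 0 ≤ C :=
  nonneg_of_mul_nonneg_left (hx.trans h) (Real.exp_pos _)

variable {A : (Fin r → ℤ) → Module.End 𝕜 E}

lemma apply_mem_lyapunovSpace (hA : ∀ m n, A (m + n) = A m * A n) {χ : (Fin r → ℝ) →ₗ[ℝ] ℝ}
    {v : E} (hv : v ∈ lyapunovSpace A χ) (n : Fin r → ℤ) : A n v ∈ lyapunovSpace A χ := by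
  intro ε hε
  obtain ⟨C, hC⟩ := hv ε hε
  have hC0 : 0 ≤ C := nonneg_of_norm_le_mul_exp (norm_nonneg _) (hC 0)
  refine ⟨C * Real.exp (χ (realVec n) + ε * ‖realVec n‖), fun m => ?_⟩
  rw [← Module.End.mul_apply, ← hA, mul_assoc, ← Real.exp_add]
  refine (hC _).trans (mul_le_mul_of_nonneg_left (Real.exp_le_exp.2 ?_) hC0)
  rw [realVec_add, map_add]
  have := mul_le_mul_of_nonneg_left (norm_add_le (realVec m) (realVec n)) hε.le
  linarith

lemma map_lyapunovSpace (h0 : A 0 = 1) (hA : ∀ m n, A (m + n) = A m * A n)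
    (χ : (Fin r → ℝ) →ₗ[ℝ] ℝ) (n : Fin r → ℤ) :
    (lyapunovSpace A χ).map (A n) = lyapunovSpace A χ := by
  refine le_antisymm ?_ fun v hv => ⟨A (-n) v, apply_mem_lyapunovSpace hA hv _, ?_⟩
  · rintro _ ⟨v, hv, rfl⟩
    exact apply_mem_lyapunovSpace hA hv n
  · rw [← Module.End.mul_apply, ← hA, add_neg_cancel, h0, Module.End.one_apply]

/-- Vectors of a Lyapunov space also satisfy a lower growth bound. -/
lemma exists_lower_bound_of_mem_lyapunovSpace [FiniteDimensional 𝕜 E]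
    (h0 : A 0 = 1) (hA : ∀ m n, A (m + n) = A m * A n) {χ : (Fin r → ℝ) →ₗ[ℝ] ℝ}
    {v : E} (hv : v ∈ lyapunovSpace A χ) (hv0 : v ≠ 0) {ε : ℝ} (hε : 0 < ε) :
    ∃ c : ℝ, 0 < c ∧ ∀ n, c * Real.exp (χ (realVec n) - ε * ‖realVec n‖) ≤ ‖A n v‖ := by
  obtain ⟨C, hC0, hC⟩ := exists_uniform_bound_of_forall_mem (lyapunovSpace A χ) A
    (fun n => Real.exp (χ (realVec n) + ε * ‖realVec n‖)) (fun n => Real.exp_pos _)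
    (fun w hw => hw ε hε)
  refine ⟨‖v‖ / C, div_pos (norm_pos_iff.2 hv0) hC0, fun n => ?_⟩
  have h := hC (-n) _ (apply_mem_lyapunovSpace hA hv n)
  rw [← Module.End.mul_apply, ← hA, neg_add_cancel, h0, Module.End.one_apply, realVec_neg,
    map_neg, norm_neg] at h
  rw [div_mul_eq_mul_div, div_le_iff₀ hC0]
  calc ‖v‖ * Real.exp (χ (realVec n) - ε * ‖realVec n‖)
      ≤ (C * Real.exp (-χ (realVec n) + ε * ‖realVec n‖) * ‖A n v‖)
        * Real.exp (χ (realVec n) - ε * ‖realVec n‖) := by gcongr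
    _ = ‖A n v‖ * C * (Real.exp (-χ (realVec n) + ε * ‖realVec n‖)
        * Real.exp (χ (realVec n) - ε * ‖realVec n‖)) := by ring
    _ = ‖A n v‖ * C := by
        rw [← Real.exp_add]
        simp

/-- Nonzero vectors of a Lyapunov space have that functional as their Lyapunov exponent. -/
lemma tendsto_of_mem_lyapunovSpace [FiniteDimensional 𝕜 E]
    (h0 : A 0 = 1) (hA : ∀ m n, A (m + n) = A m * A n) {χ : (Fin r → ℝ) →ₗ[ℝ] ℝ}
    {v : E} (hv : v ∈ lyapunovSpace A χ) (hv0 : v ≠ 0) :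
    Tendsto (fun n => (Real.log ‖A n v‖ - χ (realVec n)) / ‖realVec n‖)
      (comap (fun n : Fin r → ℤ => ‖realVec n‖) atTop) (nhds 0) := by
  rw [Metric.tendsto_nhds]
  intro ε hε
  obtain ⟨C, hC⟩ := hv (ε / 2) (half_pos hε)
  obtain ⟨c, hc0, hc⟩ := exists_lower_bound_of_mem_lyapunovSpace h0 hA hv hv0 (half_pos hε)
  have hpos : ∀ n, 0 < ‖A n v‖ := fun n => lt_of_lt_of_le (by positivity) (hc n)
  have hC0 : 0 < C := pos_of_mul_pos_left ((hpos 0).trans_le (hC 0)) (Real.exp_pos _).le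
  have hev : ∀ᶠ n in comap (fun n : Fin r → ℤ => ‖realVec n‖) atTop,
      2 * (|Real.log C| + |Real.log c| + 1) / ε < ‖realVec n‖ :=
    tendsto_comap.eventually (eventually_gt_atTop _)
  filter_upwards [hev] with n hn
  have hn0 : 0 < ‖realVec n‖ := lt_of_le_of_lt (by positivity) hn
  have hup : Real.log ‖A n v‖ ≤ Real.log C + (χ (realVec n) + ε / 2 * ‖realVec n‖) := by
    have := Real.log_le_log (hpos n) (hC n)
    rwa [Real.log_mul hC0.ne' (Real.exp_pos _).ne', Real.log_exp] at this
  have hlo : Real.log c + (χ (realVec n) - ε / 2 * ‖realVec n‖) ≤ Real.log ‖A n v‖ := by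
    have := Real.log_le_log (by positivity) (hc n)
    rwa [Real.log_mul hc0.ne' (Real.exp_pos _).ne', Real.log_exp] at this
  rw [div_lt_iff₀ hε] at hn
  rw [Real.dist_eq, sub_zero, abs_div, abs_norm, div_lt_iff₀ hn0, abs_lt]
  have h1 := le_abs_self (Real.log C)
  have h2 := neg_abs_le (Real.log c)
  have h3 := abs_nonneg (Real.log C)
  have h4 := abs_nonneg (Real.log c)
  constructor <;> linarith

end LyapunovSpace

section Independence

variable {𝕜 E : Type*} [RCLike 𝕜] [NormedAddCommGroup E] [NormedSpace 𝕜 E] {r : ℕ}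

/-- Finitely many linear functionals on `ℝ^r` are separated by a single integer vector. -/
lemma exists_realVec_injOn (s : Finset ((Fin r → ℝ) →ₗ[ℝ] ℝ)) :
    ∃ n : Fin r → ℤ, Set.InjOn (fun χ : (Fin r → ℝ) →ₗ[ℝ] ℝ => χ (realVec n)) s := by
  classical
  let p : ((Fin r → ℝ) →ₗ[ℝ] ℝ) → Polynomial ℝ := fun f =>
    ∑ j : Fin r, Polynomial.C (f (Pi.single j 1)) * Polynomial.X ^ (j : ℕ)
  have hp_eval : ∀ f, ∀ t : ℕ, (p f).eval (t : ℝ) = f (realVec fun j => (t : ℤ) ^ (j : ℕ)) := by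
    intro f t
    rw [LinearMap.pi_apply_eq_sum_univ f]
    simp only [p, Polynomial.eval_finsetSum, realVec]
    refine Finset.sum_congr rfl fun j _ => ?_
    have : (Pi.single j 1 : Fin r → ℝ) = fun i => if j = i then 1 else 0 := by
      ext i; simp [Pi.single_apply, eq_comm]
    rw [← this]
    simp only [Polynomial.eval_mul, Polynomial.eval_C, Polynomial.eval_pow, Polynomial.eval_X,
      smul_eq_mul, Int.cast_pow, Int.cast_natCast]
    exact mul_comm _ _
  have hp_ne : ∀ f, f ≠ 0 → p f ≠ 0 := by
    intro f hf hpf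
    refine hf (LinearMap.pi_ext' fun j => LinearMap.ext_ring ?_)
    have h := congrArg (fun q => Polynomial.coeff q (j : ℕ)) hpf
    simpa [p, Polynomial.finsetSum_coeff, Polynomial.coeff_X_pow, Fin.val_inj] using h
  have hq : (∏ x ∈ s.offDiag, p (x.1 - x.2)) ≠ 0 :=
    Finset.prod_ne_zero_iff.2 fun x hx =>
      hp_ne _ (sub_ne_zero.2 (Finset.mem_offDiag.1 hx).2.2)
  obtain ⟨t, ht⟩ : ∃ t : ℕ, (∏ x ∈ s.offDiag, p (x.1 - x.2)).eval (t : ℝ) ≠ 0 := by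
    by_contra! h
    refine hq (Polynomial.eq_zero_of_infinite_isRoot _ ?_)
    exact (Set.infinite_range_of_injective (Nat.cast_injective (R := ℝ))).mono
      (by rintro _ ⟨t, rfl⟩; exact h t)
  refine ⟨fun j => (t : ℤ) ^ (j : ℕ), fun χ hχ ψ hψ h => ?_⟩
  by_contra hne
  rw [Polynomial.eval_prod, Finset.prod_ne_zero_iff] at ht
  refine ht (χ, ψ) (Finset.mem_offDiag.2 ⟨hχ, hψ, hne⟩) ?_
  rw [hp_eval, LinearMap.sub_apply, sub_eq_zero]
  exact h

variable {A : (Fin r → ℤ) → Module.End 𝕜 E}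

lemma iSupIndep_lyapunovSpace [FiniteDimensional 𝕜 E]
    (h0 : A 0 = 1) (hA : ∀ m n, A (m + n) = A m * A n) : iSupIndep (lyapunovSpace A) := by
  classical
  refine iSupIndep_of_dfinsupp_lsum_injective _ ((injective_iff_map_eq_zero _).2 fun v hv => ?_)
  by_contra hne
  obtain ⟨n, hn⟩ := exists_realVec_injOn v.support
  obtain ⟨χ, hχ, hmax⟩ := v.support.exists_max_image (fun χ => χ (realVec n))
    (Finset.nonempty_iff_ne_empty.2 fun h => hne (DFinsupp.support_eq_empty.1 h))
  have hlt : ∀ ψ ∈ v.support.erase χ, ψ (realVec n) < χ (realVec n) := fun ψ hψ =>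
    lt_of_le_of_ne (hmax ψ (Finset.mem_of_mem_erase hψ)) fun h =>
      Finset.ne_of_mem_erase hψ (hn (Finset.mem_of_mem_erase hψ) hχ h)
  obtain ⟨ε, hε, hgap⟩ : ∃ ε : ℝ, 0 < ε ∧ ∀ ψ ∈ v.support.erase χ,
      ψ (realVec n) + ε * ‖realVec n‖ < χ (realVec n) - ε * ‖realVec n‖ := by
    have hev : ∀ᶠ ε : ℝ in nhdsWithin 0 (Set.Ioi 0), ∀ ψ ∈ v.support.erase χ,
        ψ (realVec n) + ε * ‖realVec n‖ < χ (realVec n) - ε * ‖realVec n‖ := by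
      refine (eventually_all_finset _).2 fun ψ hψ => ?_
      have h1 : Tendsto (fun ε : ℝ => ψ (realVec n) + ε * ‖realVec n‖) (nhds 0)
          (nhds (ψ (realVec n))) := Continuous.tendsto' (by fun_prop) _ _ (by simp)
      have h2 : Tendsto (fun ε : ℝ => χ (realVec n) - ε * ‖realVec n‖) (nhds 0)
          (nhds (χ (realVec n))) := Continuous.tendsto' (by fun_prop) _ _ (by simp)
      exact (h1.eventually_lt h2 (hlt ψ hψ)).filter_mono nhdsWithin_le_nhds
    obtain ⟨ε, h1, h2⟩ := (hev.and self_mem_nhdsWithin).exists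
    exact ⟨ε, h2, h1⟩
  have hsum : ∑ ψ ∈ v.support, (v ψ : E) = 0 := by
    rw [← hv, DFinsupp.lsum_apply_apply, DFinsupp.sumAddHom_apply, DFinsupp.sum]
    rfl
  have hvχ : (v χ : E) = -∑ ψ ∈ v.support.erase χ, (v ψ : E) := by
    rw [← Finset.add_sum_erase _ _ hχ] at hsum
    exact eq_neg_of_add_eq_zero_left hsum
  obtain ⟨c, hc0, hc⟩ := exists_lower_bound_of_mem_lyapunovSpace h0 hA (v χ).2
    (fun h => DFinsupp.mem_support_iff.1 hχ (Subtype.ext h)) hε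
  choose C hC using fun ψ => (v ψ).2 ε hε
  have hexp : ∀ (δ : ℝ) (ψ : (Fin r → ℝ) →ₗ[ℝ] ℝ) (k : ℕ),
      ψ (realVec (k • n)) + δ * ‖realVec (k • n)‖ = k * (ψ (realVec n) + δ * ‖realVec n‖) := by
    intro δ ψ k
    rw [realVec_nsmul, map_smul, norm_smul, smul_eq_mul, Real.norm_natCast]
    ring
  have hle : ∀ k : ℕ, c ≤ ∑ ψ ∈ v.support.erase χ, C ψ *
      Real.exp (k * ((ψ (realVec n) + ε * ‖realVec n‖)
        - (χ (realVec n) - ε * ‖realVec n‖))) := by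
    intro k
    have h1 : c * Real.exp (k * (χ (realVec n) - ε * ‖realVec n‖)) ≤
        ∑ ψ ∈ v.support.erase χ, C ψ * Real.exp (k * (ψ (realVec n) + ε * ‖realVec n‖)) := by
      have h2 := hc (k • n)
      rw [sub_eq_add_neg, ← neg_mul, hexp, hvχ, map_neg, norm_neg, map_sum, neg_mul,
        ← sub_eq_add_neg] at h2
      refine h2.trans ((norm_sum_le _ _).trans (Finset.sum_le_sum fun ψ _ => ?_))
      rw [← hexp]
      exact hC ψ (k • n)
    rw [← le_div_iff₀ (Real.exp_pos _), Finset.sum_div] at h1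
    refine h1.trans_eq (Finset.sum_congr rfl fun ψ _ => ?_)
    rw [mul_div_assoc, ← Real.exp_sub, ← mul_sub]
  have hlim : Tendsto (fun k : ℕ => ∑ ψ ∈ v.support.erase χ, C ψ *
      Real.exp (k * ((ψ (realVec n) + ε * ‖realVec n‖)
        - (χ (realVec n) - ε * ‖realVec n‖)))) atTop (nhds 0) := by
    rw [← Finset.sum_const_zero (s := v.support.erase χ)]
    refine tendsto_finsetSum _ fun ψ hψ => ?_
    rw [← mul_zero (C ψ)]
    refine (Real.tendsto_exp_atBot.comp ?_).const_mul _
    exact tendsto_natCast_atTop_atTop.atTop_mul_const_of_neg (sub_neg.2 (hgap ψ hψ))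
  exact absurd (ge_of_tendsto' hlim hle) (not_le.2 hc0)

end Independence

section Weights

variable {E : Type*} [NormedAddCommGroup E] [NormedSpace ℂ E]

/-- A generalized eigenvector of an invertible operator, with eigenvalue `μ`, grows like `|μ| ^ k`
up to subexponential error, in both time directions. -/
lemma exists_bound_of_sub_smul_pow_apply_eq_zero {B : ℤ → Module.End ℂ E} (h0 : B 0 = 1)
    (hB : ∀ k l, B (k + l) = B k * B l) {μ : ℂ} (hμ : μ ≠ 0) {ε : ℝ} (hε : 0 < ε) (p : ℕ) :
    ∀ w, ((B 1 - μ • (1 : Module.End ℂ E)) ^ p) w = 0 →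
      ∃ C : ℝ, ∀ k : ℤ, ‖B k w‖ ≤ C * Real.exp (k * Real.log ‖μ‖ + ε * |(k : ℝ)|) := by
  induction p with
  | zero => exact fun w hw => ⟨0, fun k => by simp_all⟩
  | succ p ih =>
    intro w hw
    rw [pow_succ, Module.End.mul_apply] at hw
    obtain ⟨C, hC⟩ := ih _ hw
    have hC0 : 0 ≤ C := nonneg_of_norm_le_mul_exp (norm_nonneg _) (hC 0)
    set u := (B 1 - μ • (1 : Module.End ℂ E)) w with hu
    have hstep : ∀ k, B (k + 1) w = μ • B k w + B k u := fun k => by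
      rw [hB, hu]; simp
    set ℓ := Real.log ‖μ‖ with hℓ
    have hμℓ : ‖μ‖ = Real.exp ℓ := (Real.exp_log (norm_pos_iff.2 hμ)).symm
    have hε1 : 1 < Real.exp ε := Real.one_lt_exp_iff.2 hε
    set D := max ‖w‖ (C * Real.exp (ε - ℓ) / (Real.exp ε - 1)) with hD
    have hD0 : 0 ≤ D := le_max_of_le_left (norm_nonneg _)
    have hDC : D + C * Real.exp (ε - ℓ) ≤ D * Real.exp ε := by
      have := (div_le_iff₀ (sub_pos.2 hε1)).1
        (le_max_right ‖w‖ (C * Real.exp (ε - ℓ) / (Real.exp ε - 1)))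
      rw [← hD] at this
      linarith
    have hDC' : D + C * Real.exp (-ℓ) ≤ D * Real.exp ε := by
      refine le_trans ?_ hDC
      gcongr
      linarith
    have hpos : ∀ k : ℕ, ‖B k w‖ ≤ D * Real.exp (k * ℓ + ε * k) := by
      intro k
      induction k with
      | zero => simp [h0, hD]
      | succ k ihk =>
        have hCk := hC k
        simp only [Int.cast_natCast, Nat.abs_cast] at hCk
        push_cast
        calc ‖B (k + 1) w‖ ≤ ‖μ‖ * ‖B k w‖ + ‖B k u‖ := by
              rw [hstep, ← norm_smul]; exact norm_add_le _ _
          _ ≤ Real.exp ℓ * (D * Real.exp (k * ℓ + ε * k)) + C * Real.exp (k * ℓ + ε * k) := by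
              rw [hμℓ]; gcongr
          _ = (D + C * Real.exp (-ℓ)) * Real.exp (ℓ + (k * ℓ + ε * k)) := by
              rw [add_mul, mul_assoc C, ← Real.exp_add, neg_add_cancel_left, Real.exp_add ℓ]
              ring
          _ ≤ D * Real.exp ε * Real.exp (ℓ + (k * ℓ + ε * k)) := by gcongr
          _ = D * Real.exp ((k + 1) * ℓ + ε * (k + 1)) := by
              rw [mul_assoc, ← Real.exp_add]; congr 2; ring
    have hneg : ∀ k : ℕ, ‖B (-k) w‖ ≤ D * Real.exp (-k * ℓ + ε * k) := by
      intro k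
      induction k with
      | zero => simp [h0, hD]
      | succ k ihk =>
        have hCk := hC (-(k + 1 : ℕ))
        simp only [Int.cast_neg, Int.cast_natCast, abs_neg, Nat.abs_cast] at hCk
        push_cast at hCk ⊢
        have h1 : ‖μ‖ * ‖B (-(k + 1)) w‖ ≤ ‖B (-k) w‖ + ‖B (-(k + 1)) u‖ := by
          have h2 := hstep (-(k + 1))
          rw [show (-((k : ℤ) + 1) + 1) = -k by ring] at h2
          rw [← norm_smul, h2]
          simpa using norm_sub_le (μ • B (-(k + 1)) w + B (-(k + 1)) u) (B (-(k + 1)) u)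
        have h3 : Real.exp ℓ * ‖B (-(k + 1)) w‖ ≤
            Real.exp ℓ * (D * Real.exp (-(k + 1) * ℓ + ε * (k + 1))) := by
          calc Real.exp ℓ * ‖B (-(k + 1)) w‖
              ≤ D * Real.exp (-k * ℓ + ε * k)
                + C * Real.exp (-(k + 1) * ℓ + ε * (k + 1)) := by
                rw [← hμℓ]; exact h1.trans (add_le_add ihk hCk)
            _ = (D + C * Real.exp (ε - ℓ)) * Real.exp (-k * ℓ + ε * k) := by
                rw [add_mul, mul_assoc C, ← Real.exp_add]; congr 3; ring
            _ ≤ D * Real.exp ε * Real.exp (-k * ℓ + ε * k) := by gcongr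
            _ = Real.exp ℓ * (D * Real.exp (-(k + 1) * ℓ + ε * (k + 1))) := by
                rw [mul_left_comm, mul_assoc, ← Real.exp_add, ← Real.exp_add]; congr 2; ring
        exact le_of_mul_le_mul_left h3 (Real.exp_pos _)
    refine ⟨D, fun k => ?_⟩
    obtain ⟨k, rfl | rfl⟩ := k.eq_nat_or_neg
    · simpa using hpos k
    · simpa using hneg k

variable {r : ℕ} {A : (Fin r → ℤ) → Module.End ℂ E}

/-- The functional with coordinates `log |μ j|`. -/
def logNormFunctional (μ : Fin r → ℂ) : (Fin r → ℝ) →ₗ[ℝ] ℝ :=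
  ∑ j, Real.log ‖μ j‖ • LinearMap.proj j

lemma logNormFunctional_apply (μ : Fin r → ℂ) (x : Fin r → ℝ) :
    logNormFunctional μ x = ∑ j, x j * Real.log ‖μ j‖ := by
  simp [logNormFunctional, mul_comm]

lemma iInf_maxGenEigenspace_le_lyapunovSpace [FiniteDimensional ℂ E]
    (h0 : A 0 = 1) (hA : ∀ m n, A (m + n) = A m * A n) (μ : Fin r → ℂ) :
    ⨅ j, (A (Pi.single j 1)).maxGenEigenspace (μ j) ≤
      lyapunovSpace A (logNormFunctional μ) := by
  by_cases hμ : ∃ j, μ j = 0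
  · obtain ⟨j, hj⟩ := hμ
    intro w hw
    have hw' := (Submodule.mem_iInf _).1 hw j
    rw [Module.End.mem_maxGenEigenspace, hj, zero_smul, sub_zero] at hw'
    obtain ⟨p, hp⟩ := hw'
    have hinj : Function.Injective (A (Pi.single j 1)) := by
      refine Function.LeftInverse.injective (g := A (-Pi.single j 1)) fun x => ?_
      rw [← Module.End.mul_apply, ← hA, neg_add_cancel, h0, Module.End.one_apply]
    rw [Module.End.pow_apply] at hp
    have : w = 0 := hinj.iterate p (hp.trans (by rw [← Module.End.pow_apply, map_zero]))
    exact this ▸ zero_mem _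
  push Not at hμ
  have hcomm : ∀ m n, Commute (A m) (A n) := fun m n => by
    rw [commute_iff_eq, ← hA, add_comm, hA]
  set W := ⨅ j, (A (Pi.single j 1)).maxGenEigenspace (μ j) with hW
  have hinv : ∀ n, ∀ w ∈ W, A n w ∈ W := fun n w hw =>
    (Submodule.mem_iInf _).2 fun j =>
      Module.End.mapsTo_maxGenEigenspace_of_comm (hcomm _ _) _ ((Submodule.mem_iInf _).1 hw j)
  intro w hw ε hε
  set δ := ε / (r + 1) with hδ
  have hδ0 : 0 < δ := by positivity
  have hunif : ∀ j, ∃ C : ℝ, 0 < C ∧ ∀ k : ℤ, ∀ w ∈ W, ‖A (Pi.single j k) w‖ ≤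
      C * Real.exp (k * Real.log ‖μ j‖ + δ * |(k : ℝ)|) * ‖w‖ := by
    intro j
    refine exists_uniform_bound_of_forall_mem W (fun k : ℤ => A (Pi.single j k)) _
      (fun k => Real.exp_pos _) fun w hw => ?_
    obtain ⟨p, hp⟩ := (Module.End.mem_maxGenEigenspace _ _ _).1 ((Submodule.mem_iInf _).1 hw j)
    exact exists_bound_of_sub_smul_pow_apply_eq_zero (B := fun k : ℤ => A (Pi.single j k))
      (by simp [h0]) (fun k l => by simp only [Pi.single_add, hA]) (hμ j) hδ0 p w hp
  choose C hC0 hC using hunif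
  have hprod : ∀ (n : Fin r → ℤ) (s : Finset (Fin r)), ‖A (∑ j ∈ s, Pi.single j (n j)) w‖ ≤
      (∏ j ∈ s, (C j * Real.exp (n j * Real.log ‖μ j‖ + δ * |(n j : ℝ)|))) * ‖w‖ := by
    intro n s
    induction s using Finset.induction_on with
    | empty => simp [h0]
    | insert j s hj ih =>
      rw [Finset.sum_insert hj, Finset.prod_insert hj, hA, Module.End.mul_apply, mul_assoc]
      refine (hC j (n j) _ (hinv _ w hw)).trans ?_
      have := (hC0 j).le
      gcongr
  refine ⟨(∏ j, C j) * ‖w‖, fun n => ?_⟩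
  have h1 := hprod n Finset.univ
  rw [Finset.univ_sum_single, Finset.prod_mul_distrib, ← Real.exp_sum, mul_right_comm] at h1
  refine h1.trans ?_
  have hCp : 0 ≤ ∏ j, C j := Finset.prod_nonneg fun j _ => (hC0 j).le
  gcongr
  rw [Finset.sum_add_distrib, logNormFunctional_apply]
  refine add_le_add le_rfl ?_
  calc ∑ j, δ * |(n j : ℝ)| ≤ ∑ _j : Fin r, δ * ‖realVec n‖ := by
        refine Finset.sum_le_sum fun j _ => mul_le_mul_of_nonneg_left ?_ hδ0.le
        exact norm_le_pi_norm (realVec n) j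
    _ = r * δ * ‖realVec n‖ := by simp [mul_assoc]
    _ ≤ ε * ‖realVec n‖ := by
        gcongr
        rw [hδ, mul_div_assoc', div_le_iff₀ (by positivity)]
        nlinarith

lemma iSup_lyapunovSpace_eq_top_of_complex [FiniteDimensional ℂ E]
    (h0 : A 0 = 1) (hA : ∀ m n, A (m + n) = A m * A n) : ⨆ χ, lyapunovSpace A χ = ⊤ := by
  rw [eq_top_iff, ←
    Module.End.iSup_iInf_maxGenEigenspace_eq_top_of_iSup_maxGenEigenspace_eq_top_of_commute
    (fun j => A (Pi.single j 1))
    (fun i j _ => (commute_iff_eq _ _).2 (by rw [← hA, add_comm, hA]))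
    (fun j => Module.End.iSup_maxGenEigenspace_eq_top _)]
  exact iSup_le fun μ => (iInf_maxGenEigenspace_le_lyapunovSpace h0 hA μ).trans
    (le_iSup (lyapunovSpace A) _)

end Weights

section Complexification

variable {L : Type*} [NormedAddCommGroup L] [NormedSpace ℝ L] {r : ℕ}
  {ι : Type*} [Fintype ι] [DecidableEq ι]

/-- Extension of scalars from `ℝ` to `ℂ` for endomorphisms, in coordinates. -/
def complexifyEnd (b : Module.Basis ι ℝ L) : Module.End ℝ L →+* Module.End ℂ (ι → ℂ) :=
  ((Matrix.toLinAlgEquiv' (R := ℂ) (n := ι)).toRingEquiv.toRingHom.comp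
    (algebraMap ℝ ℂ).mapMatrix).comp (LinearMap.toMatrixAlgEquiv b).toRingEquiv.toRingHom

/-- The vector whose coordinates are the real parts of the given complex coordinates. -/
def realPartInBasis (b : Module.Basis ι ℝ L) : (ι → ℂ) →ₗ[ℝ] L :=
  b.equivFun.symm.toLinearMap ∘ₗ LinearMap.pi fun i => Complex.reLm ∘ₗ LinearMap.proj i

lemma realPartInBasis_complexifyEnd (b : Module.Basis ι ℝ L) (f : Module.End ℝ L) (w : ι → ℂ) :
    realPartInBasis b (complexifyEnd b f w) = f (realPartInBasis b w) := by
  rw [← b.equivFun.injective.eq_iff]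
  have h := LinearMap.toMatrix_mulVec_repr b b f (realPartInBasis b w)
  ext i
  have h2 := congrFun h i
  simp only [Module.Basis.equivFun_apply]
  rw [← h2]
  simp [realPartInBasis, complexifyEnd, Matrix.mulVec, dotProduct, LinearMap.toMatrixAlgEquiv_apply,
    LinearMap.toMatrix_apply, Module.Basis.equivFun_symm_apply, Finsupp.single_apply]

lemma iSup_lyapunovSpace_eq_top [FiniteDimensional ℝ L] {A : (Fin r → ℤ) → Module.End ℝ L}
    (h0 : A 0 = 1) (hA : ∀ m n, A (m + n) = A m * A n) : ⨆ χ, lyapunovSpace A χ = ⊤ := by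
  let b := Module.finBasis ℝ L
  have hC := iSup_lyapunovSpace_eq_top_of_complex (A := fun n => complexifyEnd b (A n))
    (by simp [h0]) (fun m n => by simp [hA])
  have key : ∀ w, realPartInBasis b w ∈ ⨆ χ, lyapunovSpace A χ := by
    intro w
    have hw : w ∈ ⨆ χ, lyapunovSpace (fun n => complexifyEnd b (A n)) χ := hC ▸ Submodule.mem_top
    induction hw using Submodule.iSup_induction' with
    | mem χ w hw =>
      refine Submodule.mem_iSup_of_mem χ fun ε hε => ?_
      obtain ⟨C, hC⟩ := hw ε hε
      let P := LinearMap.toContinuousLinearMap (realPartInBasis b)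
      refine ⟨‖P‖ * C, fun n => ?_⟩
      rw [← realPartInBasis_complexifyEnd, mul_assoc]
      exact P.le_opNorm_of_le (hC n)
    | zero => simp
    | add v w _ _ hv hw => rw [map_add]; exact add_mem hv hw
  refine eq_top_iff.2 fun v _ => ?_
  convert key fun i => (b.repr v i : ℂ)
  simp [realPartInBasis, Module.Basis.equivFun_symm_apply, b.sum_repr]

end Complexification

/-- coarse-free Lyapunov decomposition for a `ℤ^r`-action by Lie algebra
automorphisms. -/
theorem lyapunov_decomposition
    {L : Type*} [NormedAddCommGroup L] [NormedSpace ℝ L] [FiniteDimensional ℝ L]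
    [Nontrivial L]
    (B : L →ₗ[ℝ] L →ₗ[ℝ] L)  -- the Lie bracket
    (hBalt : ∀ x : L, B x x = 0)
    (hBjac : ∀ x y z : L, B x (B y z) + B y (B z x) + B z (B x y) = 0)
    {r : ℕ} (α : (Fin r → ℤ) → (L ≃ₗ[ℝ] L))
    (hαhom : ∀ m n : Fin r → ℤ, α (m + n) = (α n).trans (α m))
    (hαbracket : ∀ (n : Fin r → ℤ) (x y : L), α n (B x y) = B (α n x) (α n y)) :
    ∃ (m : ℕ) (χ : Fin m → ((Fin r → ℝ) →ₗ[ℝ] ℝ)) (V : Fin m → Submodule ℝ L),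
      Function.Injective χ ∧
      (∀ i, V i ≠ ⊥) ∧
      (∀ i (n : Fin r → ℤ), (V i).map (α n : L →ₗ[ℝ] L) = V i) ∧
      -- (1) direct sum decomposition of 𝔤:
      iSupIndep V ∧ (⨆ i, V i) = ⊤ ∧
      -- (2) the Lyapunov exponent of every nonzero vector of V i is χ i:
      (∀ i, ∀ v ∈ V i, v ≠ 0 →
        Tendsto
          (fun n : Fin r → ℤ =>
            (Real.log ‖α n v‖ - χ i (fun j => (n j : ℝ))) / ‖(fun j => (n j : ℝ))‖)
          (Filter.comap (fun n : Fin r → ℤ => ‖(fun j => (n j : ℝ))‖) atTop)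
          (nhds 0)) ∧
      -- (3) behaviour of the bracket on Lyapunov subspaces:
      (∀ i j : Fin m,
        (∀ k : Fin m, χ k = χ i + χ j →
          ∀ x ∈ V i, ∀ y ∈ V j, B x y ∈ V k) ∧
        ((∀ k : Fin m, χ k ≠ χ i + χ j) →
          ∀ x ∈ V i, ∀ y ∈ V j, B x y = 0)) := by
  let A : (Fin r → ℤ) → Module.End ℝ L := fun n => (α n : L →ₗ[ℝ] L)
  have hA : ∀ m n, A (m + n) = A m * A n := fun m n => by
    ext v
    simp [A, hαhom]
  have h0 : A 0 = 1 := by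
    ext v
    refine (α 0).injective ?_
    have := congrArg (fun f : Module.End ℝ L => f v) (hA 0 0)
    simpa [A] using this.symm
  have hind := iSupIndep_lyapunovSpace h0 hA
  have hfin : Finite {χ // lyapunovSpace A χ ≠ ⊥} := Submodule.finite_ne_bot_of_iSupIndep hind
  obtain ⟨m, ⟨e⟩⟩ := Finite.exists_equiv_fin {χ // lyapunovSpace A χ ≠ ⊥}
  have hbr : ∀ χ ψ, ∀ x ∈ lyapunovSpace A χ, ∀ y ∈ lyapunovSpace A ψ,
      B x y ∈ lyapunovSpace A (χ + ψ) := by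
    intro χ ψ x hx y hy ε hε
    obtain ⟨C, hC⟩ := hx (ε / 2) (half_pos hε)
    obtain ⟨D, hD⟩ := hy (ε / 2) (half_pos hε)
    have hC0 : 0 ≤ C := nonneg_of_norm_le_mul_exp (norm_nonneg _) (hC 0)
    let Bc : L →L[ℝ] L →L[ℝ] L :=
      LinearMap.toContinuousLinearMap (LinearMap.toContinuousLinearMap.toLinearMap ∘ₗ B)
    refine ⟨‖Bc‖ * C * D, fun n => ?_⟩
    calc ‖A n (B x y)‖ = ‖Bc (A n x) (A n y)‖ := by
          simp only [A, Bc, LinearEquiv.coe_coe, hαbracket]; rfl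
      _ ≤ ‖Bc‖ * ‖A n x‖ * ‖A n y‖ := Bc.le_opNorm₂ _ _
      _ ≤ ‖Bc‖ * (C * Real.exp (χ (realVec n) + ε / 2 * ‖realVec n‖)) *
          (D * Real.exp (ψ (realVec n) + ε / 2 * ‖realVec n‖)) := by
          gcongr
          · exact hC n
          · exact hD n
      _ = ‖Bc‖ * C * D * (Real.exp (χ (realVec n) + ε / 2 * ‖realVec n‖) *
          Real.exp (ψ (realVec n) + ε / 2 * ‖realVec n‖)) := by ring
      _ = ‖Bc‖ * C * D * Real.exp ((χ + ψ) (realVec n) + ε * ‖realVec n‖) := by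
          rw [← Real.exp_add, LinearMap.add_apply]
          congr 2
          ring
  refine ⟨m, fun i => (e.symm i).1, fun i => lyapunovSpace A (e.symm i).1,
    Subtype.val_injective.comp e.symm.injective, fun i => (e.symm i).2,
    fun i n => map_lyapunovSpace h0 hA _ n,
    hind.comp (Subtype.val_injective.comp e.symm.injective), ?_,
    fun i v hv hv0 => tendsto_of_mem_lyapunovSpace h0 hA hv hv0, fun i j => ⟨?_, ?_⟩⟩
  · rw [e.symm.iSup_comp (g := fun χ : {χ // lyapunovSpace A χ ≠ ⊥} => lyapunovSpace A χ.1),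
      iSup_ne_bot_subtype, iSup_lyapunovSpace_eq_top h0 hA]
  · intro k hk x hx y hy
    simpa only [hk] using hbr _ _ x hx y hy
  · intro hne x hx y hy
    have hbot : lyapunovSpace A ((e.symm i).1 + (e.symm j).1) = ⊥ := by
      by_contra h
      exact hne (e ⟨_, h⟩) (by simp only [e.symm_apply_apply])
    exact (Submodule.mem_bot ℝ).1 (hbot ▸ hbr _ _ x hx y hy)

end
end

section
/- Let W be a nonzero finite-dimensional real vector space with its Borel σ-algebra, let φ : ℤ^r → GL(W) be a group homomorphism, and let ρ be a Borel probability measure on W that is invariant under every φ(n) and ergodic for this ℤ^r-action (every Borel set invariant under all φ(n) has ρ-measure 0 or 1). Then there exist a linear subspace W_0 ⊆ W invariant under every φ(n), a positive-definite inner product q_0 on W_0 that is preserved by the restriction of every φ(n) to W_0, and a radius R ≥ 0, such that ρ gives full measure to the sphere {w ∈ W_0 : q_0(w,w) = R²} inside W_0. -/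
/-!
STATEMENT 12: Let W be a nonzero finite-dimensional real vector space with its Borel
σ-algebra, let φ : ℤ^r → GL(W) be a group homomorphism, and let ρ be a Borel probability
measure on W invariant under every φ(n) and ergodic for this ℤ^r-action.  Then there exist
a φ-invariant linear subspace W₀ ⊆ W, a positive-definite inner product q₀ on W₀ preserved
by the restriction of every φ(n) to W₀, and a radius R ≥ 0, such that ρ gives full measure
to the sphere {w ∈ W₀ : q₀(w,w) = R²}.
-/

open MeasureTheory

open Filter Topology

/-- A family of operators preserving a probability measure that charges fully no proper subspace
is bounded. -/
theorem exists_norm_le_of_map_eq {V ι : Type*} [NormedAddCommGroup V] [NormedSpace ℝ V]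
    [FiniteDimensional ℝ V] [MeasurableSpace V] [BorelSpace V] (T : ι → V →L[ℝ] V)
    (μ : Measure V) [IsProbabilityMeasure μ] (hinv : ∀ i, μ.map (T i) = μ)
    (hfull : ∀ U : Submodule ℝ V, μ U = 1 → U = ⊤) :
    ∃ C, 0 ≤ C ∧ ∀ i, ‖T i‖ ≤ C := by
  by_contra! hcon
  choose i hi using fun k : ℕ => hcon k k.cast_nonneg
  have hpos : ∀ k, 0 < ‖T (i k)‖ := fun k => k.cast_nonneg.trans_lt (hi k)
  have : ProperSpace (V →L[ℝ] V) := FiniteDimensional.proper ℝ _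
  obtain ⟨L, hL, ns, hns, hlim⟩ := (isCompact_sphere (0 : V →L[ℝ] V) 1).tendsto_subseq
    (x := fun k => ‖T (i k)‖⁻¹ • T (i k))
    (fun k => by simp [norm_smul, (hpos k).ne'])
  have hinvnorm : Tendsto (fun k => ‖T (i (ns k))‖⁻¹) atTop (𝓝 0) :=
    (tendsto_atTop_mono (fun k => (hi k).le) tendsto_natCast_atTop_atTop).inv_tendsto_atTop.comp
      hns.tendsto_atTop
  have hscale : TendstoInMeasure μ (fun k w => ‖T (i (ns k))‖⁻¹ • w) atTop (fun _ => (0 : V)) :=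
    tendstoInMeasure_of_tendsto_ae
      (fun k => (continuous_const_smul _).aestronglyMeasurable)
      (ae_of_all _ fun w => by simpa using hinvnorm.smul_const w)
  have hzero : TendstoInMeasure μ (fun k w => (‖T (i (ns k))‖⁻¹ • T (i (ns k))) w) atTop
      (fun _ => (0 : V)) := by
    rw [tendstoInMeasure_iff_norm] at hscale ⊢
    intro ε hε
    refine (hscale ε hε).congr fun k => ?_
    have hmeas : MeasurableSet {w : V | ε ≤ ‖‖T (i (ns k))‖⁻¹ • w - 0‖} :=
      (isClosed_le continuous_const (by fun_prop)).measurableSet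
    conv_lhs => rw [← hinv (i (ns k)), Measure.map_apply (T _).continuous.measurable hmeas]
    rfl
  have hL' : TendstoInMeasure μ (fun k w => (‖T (i (ns k))‖⁻¹ • T (i (ns k))) w) atTop L :=
    tendstoInMeasure_of_tendsto_ae
      (fun k => (ContinuousLinearMap.continuous _).aestronglyMeasurable)
      (ae_of_all _ fun w => ((ContinuousLinearMap.apply ℝ V w).continuous.tendsto L).comp hlim)
  have hker : μ (LinearMap.ker (L : V →ₗ[ℝ] V)) = 1 := by
    rw [← prob_compl_eq_zero_iff
      (LinearMap.ker (L : V →ₗ[ℝ] V)).closed_of_finiteDimensional.measurableSet]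
    exact tendstoInMeasure_ae_unique hL' hzero
  have hLzero : L = 0 := by
    ext w
    have hw : w ∈ LinearMap.ker (L : V →ₗ[ℝ] V) := by simp [hfull _ hker]
    simpa using hw
  simp [hLzero] at hL

/-- A probability measure with bounded support which charges fully no proper subspace determines
an inner product, the inverse of its second moment form, invariant under every linear
equivalence preserving the measure. -/
theorem exists_inner_of_ae_norm_le {V : Type*} [NormedAddCommGroup V] [NormedSpace ℝ V]
    [FiniteDimensional ℝ V] [MeasurableSpace V] [BorelSpace V]
    (μ : Measure V) [IsProbabilityMeasure μ] (C : ℝ) (hC : ∀ᵐ w ∂μ, ‖w‖ ≤ C)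
    (hfull : ∀ U : Submodule ℝ V, μ U = 1 → U = ⊤) :
    ∃ q : V →ₗ[ℝ] V →ₗ[ℝ] ℝ, (∀ x y, q x y = q y x) ∧ (∀ x, x ≠ 0 → 0 < q x x) ∧
      ∀ e : V ≃ₗ[ℝ] V, μ.map e = μ → ∀ x y, q (e x) (e y) = q x y := by
  have hcont (l : Module.Dual ℝ V) : Continuous l := l.continuous_of_finiteDimensional
  have hint (l : Module.Dual ℝ V) : Integrable (fun w => l w • w) μ := by
    refine Integrable.of_bound ((hcont l).smul continuous_id).aestronglyMeasurable
      (‖LinearMap.toContinuousLinearMap l‖ * C * C) ?_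
    filter_upwards [hC] with w hw
    rw [norm_smul]
    have hlw : ‖l w‖ ≤ ‖LinearMap.toContinuousLinearMap l‖ * ‖w‖ :=
      (LinearMap.toContinuousLinearMap l).le_opNorm w
    have hC0 : 0 ≤ C := (norm_nonneg w).trans hw
    calc ‖l w‖ * ‖w‖ ≤ (‖LinearMap.toContinuousLinearMap l‖ * ‖w‖) * ‖w‖ := by gcongr
      _ ≤ _ := by gcongr
  let S : Module.Dual ℝ V →ₗ[ℝ] V :=
    { toFun := fun l => ∫ w, l w • w ∂μ
      map_add' := fun l m => by
        simp only [LinearMap.add_apply, add_smul]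
        exact integral_add (hint l) (hint m)
      map_smul' := fun c l => by
        simp only [LinearMap.smul_apply, smul_assoc, RingHom.id_apply]
        exact integral_smul c _ }
  have hS (l m : Module.Dual ℝ V) : m (S l) = ∫ w, l w * m w ∂μ := by
    have := (LinearMap.toContinuousLinearMap m).integral_comp_comm (hint l)
    simpa [S] using this.symm
  have hSint (l : Module.Dual ℝ V) : Integrable (fun w => l w * l w) μ := by
    have := (LinearMap.toContinuousLinearMap l).integrable_comp (hint l)
    simpa using this
  have hSpos (l : Module.Dual ℝ V) (hl : l ≠ 0) : 0 < l (S l) := by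
    rw [hS]
    refine (integral_nonneg fun w => mul_self_nonneg _).lt_of_ne' fun h => hl ?_
    rw [integral_eq_zero_iff_of_nonneg (fun w => mul_self_nonneg _) (hSint l)] at h
    have hker : μ (LinearMap.ker l) = 1 := by
      rw [← prob_compl_eq_zero_iff (LinearMap.ker l).closed_of_finiteDimensional.measurableSet]
      exact h.mono fun w hw => mul_self_eq_zero.1 hw
    exact LinearMap.ker_eq_top.1 (hfull _ hker)
  have hSinj : Function.Injective S := by
    rw [injective_iff_map_eq_zero]
    intro l hl
    by_contra hne
    simpa [hl] using hSpos l hne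
  let E : Module.Dual ℝ V ≃ₗ[ℝ] V :=
    LinearEquiv.ofInjectiveOfFinrankEq S hSinj Subspace.dual_finrank_eq
  have hE (l : Module.Dual ℝ V) : E l = S l := rfl
  refine ⟨E.symm.toLinearMap, fun x y => ?_, fun x hx => ?_, fun e he x y => ?_⟩
  · obtain ⟨l, rfl⟩ := E.surjective x
    obtain ⟨m, rfl⟩ := E.surjective y
    simp only [LinearEquiv.coe_coe, LinearEquiv.symm_apply_apply]
    simp only [hE, hS, mul_comm]
  · obtain ⟨l, rfl⟩ := E.surjective x
    simp only [LinearEquiv.coe_coe, LinearEquiv.symm_apply_apply]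
    exact hSpos l (by rintro rfl; simp at hx)
  · obtain ⟨l, rfl⟩ := E.surjective x
    have hEl : e (E l) = E (l ∘ₗ e.symm.toLinearMap) := by
      have hec : Continuous e := e.toLinearMap.continuous_of_finiteDimensional
      have hcomm := (LinearMap.toContinuousLinearMap e.toLinearMap).integral_comp_comm (hint l)
      have hmap := integral_map (μ := μ) hec.measurable.aemeasurable
        (f := fun w => (l ∘ₗ e.symm.toLinearMap) w • w)
        ((hcont _).smul continuous_id).aestronglyMeasurable
      rw [he] at hmap
      simpa [hE, S] using hcomm.symm.trans (by simpa using hmap.symm)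
    simp [hEl]

/-- An ergodic invariant probability measure charging fully no proper subspace is carried by a
sphere for an invariant inner product. -/
theorem exists_invariant_inner_sphere {V G : Type*} [NormedAddCommGroup V] [NormedSpace ℝ V]
    [FiniteDimensional ℝ V] [MeasurableSpace V] [BorelSpace V] [Group G]
    (π : Representation ℝ G V) (μ : Measure V) [IsProbabilityMeasure μ]
    (hinv : ∀ g, μ.map (π g) = μ)
    (herg : ∀ s : Set V, MeasurableSet s → (∀ g, π g ⁻¹' s = s) → μ s = 0 ∨ μ s = 1)
    (hfull : ∀ U : Submodule ℝ V, μ U = 1 → U = ⊤) :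
    ∃ q : V →ₗ[ℝ] V →ₗ[ℝ] ℝ, (∀ x y, q x y = q y x) ∧ (∀ x, x ≠ 0 → 0 < q x x) ∧
      (∀ g x y, q (π g x) (π g y) = q x y) ∧ ∃ R : ℝ, 0 ≤ R ∧ μ {w | q w w = R ^ 2} = 1 := by
  have hcont (g : G) : Continuous (π g) := (π g).continuous_of_finiteDimensional
  obtain ⟨C, hC0, hC⟩ := exists_norm_le_of_map_eq
    (fun g => LinearMap.toContinuousLinearMap (π g)) μ hinv hfull
  obtain ⟨M, hM⟩ : ∃ M : ℕ, μ (Metric.closedBall 0 M) ≠ 0 := by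
    by_contra! h
    have huniv := measure_iUnion_null h
    rw [Metric.iUnion_closedBall_nat] at huniv
    simp at huniv
  let B : Set V := {w | ∀ g, ‖π g w‖ ≤ C * M}
  have hBmeas : MeasurableSet B := by
    simp only [B, Set.ofPred_forall]
    exact (isClosed_iInter fun g => isClosed_le (hcont g).norm continuous_const).measurableSet
  have hBinv (g : G) : π g ⁻¹' B = B := by
    ext w
    refine ⟨fun h a => ?_, fun h a => ?_⟩
    · simpa [← Module.End.mul_apply, ← map_mul] using h (a * g⁻¹)
    · simpa using h (a * g)
  have hBball : Metric.closedBall 0 (M : ℝ) ⊆ B := fun w hw g =>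
    ((LinearMap.toContinuousLinearMap (π g)).le_opNorm w).trans
      (mul_le_mul (hC g) (by simpa using hw) (norm_nonneg _) hC0)
  have hB : μ B = 1 := (herg B hBmeas hBinv).resolve_left fun h => hM (measure_mono_null hBball h)
  have hbound : ∀ᵐ w ∂μ, ‖w‖ ≤ C * M := by
    filter_upwards [(prob_compl_eq_zero_iff hBmeas).2 hB] with w hw
    simpa using hw 1
  obtain ⟨q, hsymm, hpos, hq⟩ := exists_inner_of_ae_norm_le μ _ hbound hfull
  have hqinv (g : G) (x y : V) : q (π g x) (π g y) = q x y :=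
    hq (LinearEquiv.ofBijective (π g) (π.apply_bijective g)) (hinv g) x y
  have hqmeas : Measurable fun w => q w w := by
    have : Continuous fun w => LinearMap.toContinuousLinearMap
        (LinearMap.toContinuousLinearMap.toLinearMap ∘ₗ q) w w := by fun_prop
    exact this.measurable
  obtain ⟨c, hc⟩ : ∃ c, (fun w => q w w) =ᵐ[μ] Function.const V c := by
    refine exists_eventuallyEq_const_of_forall_separating MeasurableSet fun U hU => ?_
    have hU' := hqmeas hU
    rcases herg _ hU' (fun g => by ext w; simp [hqinv]) with h | h
    · exact Or.inr (measure_eq_zero_iff_ae_notMem.1 h)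
    · exact Or.inl ((prob_compl_eq_zero_iff hU').2 h)
  have hc0 : 0 ≤ c := by
    obtain ⟨w, hw⟩ := hc.exists
    rw [← show q w w = c from hw]
    rcases eq_or_ne w 0 with rfl | hne
    · simp
    · exact (hpos w hne).le
  refine ⟨q, hsymm, hpos, hqinv, √c, Real.sqrt_nonneg c, ?_⟩
  rw [Real.sq_sqrt hc0]
  exact (prob_compl_eq_zero_iff (hqmeas (measurableSet_singleton c))).1 hc

/-- A probability measure on a finite-dimensional space has a smallest subspace of full measure. -/
theorem exists_least_submodule_measure_eq_one {V : Type*} [NormedAddCommGroup V]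
    [NormedSpace ℝ V] [FiniteDimensional ℝ V] [MeasurableSpace V] [BorelSpace V]
    (μ : Measure V) [IsProbabilityMeasure μ] :
    ∃ U : Submodule ℝ V, IsLeast {U : Submodule ℝ V | μ U = 1} U := by
  obtain ⟨U, hU, hmin⟩ := exists_minimal_of_wellFoundedLT (fun U : Submodule ℝ V => μ U = 1)
    ⟨⊤, by simp⟩
  have hmeas (U : Submodule ℝ V) : MeasurableSet (U : Set V) :=
    U.closed_of_finiteDimensional.measurableSet
  refine ⟨U, hU, fun U' hU' => ?_⟩
  refine (hmin (y := U ⊓ U') ?_ inf_le_left).trans inf_le_right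
  have h := (prob_compl_eq_zero_iff (hmeas U)).2 hU
  have h' := (prob_compl_eq_zero_iff (hmeas U')).2 hU'
  refine (prob_compl_eq_zero_iff (hmeas _)).1 ?_
  rw [Submodule.coe_inf, Set.compl_inter]
  exact measure_union_null h h'

theorem ergodic_invariant_measure_supported_on_isometric_sphere
    {W : Type*} [NormedAddCommGroup W] [NormedSpace ℝ W] [FiniteDimensional ℝ W]
    [Nontrivial W] [MeasurableSpace W] [BorelSpace W]
    {r : ℕ} (φ : (Fin r → ℤ) → (W ≃ₗ[ℝ] W))
    (hφhom : ∀ m n : Fin r → ℤ, φ (m + n) = (φ n).trans (φ m))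
    (ρ : Measure W) [IsProbabilityMeasure ρ]
    (hρinv : ∀ n, Measure.map (φ n) ρ = ρ)
    (hρerg : ∀ s : Set W, MeasurableSet s → (∀ n, φ n ⁻¹' s = s) → ρ s = 0 ∨ ρ s = 1) :
    ∃ W₀ : Submodule ℝ W,
      ∃ hinv : ∀ (n : Fin r → ℤ), ∀ w ∈ W₀, φ n w ∈ W₀,
      ∃ q₀ : W₀ →ₗ[ℝ] W₀ →ₗ[ℝ] ℝ,
        (∀ x y : W₀, q₀ x y = q₀ y x) ∧
        (∀ x : W₀, x ≠ 0 → 0 < q₀ x x) ∧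
        -- every φ(n) restricts to an isometry of (W₀, q₀):
        (∀ (n : Fin r → ℤ) (x y : W₀),
          q₀ ⟨φ n x, hinv n x x.2⟩ ⟨φ n y, hinv n y y.2⟩ = q₀ x y) ∧
        ∃ R : ℝ, 0 ≤ R ∧
          ρ {w : W | ∃ hw : w ∈ W₀, q₀ ⟨w, hw⟩ ⟨w, hw⟩ = R ^ 2} = 1 := by
  have hzero (w : W) : φ 0 w = w := by
    have h := congrArg (fun f : W ≃ₗ[ℝ] W => f w) (hφhom 0 0)
    exact (φ 0).injective (by simpa using h.symm)
  have hadd (m n : Fin r → ℤ) (w : W) : φ (m + n) w = φ m (φ n w) := by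
    rw [hφhom]
    rfl
  have hcont (n : Fin r → ℤ) : Continuous (φ n) :=
    (φ n).toLinearMap.continuous_of_finiteDimensional
  obtain ⟨W₀, hW₀, hleast⟩ := exists_least_submodule_measure_eq_one ρ
  have hmeas : MeasurableSet (W₀ : Set W) := W₀.closed_of_finiteDimensional.measurableSet
  have hinv (n : Fin r → ℤ) (w : W) (hw : w ∈ W₀) : φ n w ∈ W₀ := by
    refine hleast (a := W₀.comap (φ n).toLinearMap) ?_ hw
    have hmap := Measure.map_apply (μ := ρ) (hcont n).measurable hmeas
    rw [hρinv, hW₀] at hmap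
    exact hmap.symm
  let π : Representation ℝ (Multiplicative (Fin r → ℤ)) W₀ :=
    { toFun := fun n => (φ n.toAdd).toLinearMap.restrict (hinv n.toAdd)
      map_one' := by
        ext w
        exact hzero w
      map_mul' := fun m n => by
        ext w
        exact hadd m.toAdd n.toAdd w }
  have hemb : MeasurableEmbedding (Subtype.val : W₀ → W) := MeasurableEmbedding.subtype_coe hmeas
  let μ : Measure W₀ := ρ.comap Subtype.val
  have hμ (s : Set W₀) : μ s = ρ (Subtype.val '' s) := hemb.comap_apply ρ s
  have : IsProbabilityMeasure μ := ⟨by rw [hμ, Set.image_univ, Subtype.range_coe]; exact hW₀⟩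
  have hpre (n : Multiplicative (Fin r → ℤ)) (s : Set W₀) :
      φ n.toAdd ⁻¹' (Subtype.val '' s) = Subtype.val '' (π n ⁻¹' s) := by
    ext w
    constructor
    · rintro ⟨v, hv, hvw⟩
      have hw : w ∈ W₀ := by
        have h := hinv (-n.toAdd) _ (hvw ▸ v.2)
        rwa [← hadd, neg_add_cancel, hzero] at h
      refine ⟨⟨w, hw⟩, ?_, rfl⟩
      rwa [Set.mem_preimage, show π n ⟨w, hw⟩ = v from Subtype.ext hvw.symm]
    · rintro ⟨v, hv, rfl⟩
      exact ⟨π n v, hv, rfl⟩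
  obtain ⟨q, hsymm, hpos, hq, R, hR, hsphere⟩ := exists_invariant_inner_sphere π μ
    (fun n => by
      ext s hs
      rw [Measure.map_apply (π n).continuous_of_finiteDimensional.measurable hs, hμ, hμ, ← hpre,
        ← Measure.map_apply (hcont _).measurable (hemb.measurableSet_image.2 hs), hρinv])
    (fun s hs hsinv => by
      rw [hμ]
      refine hρerg _ (hemb.measurableSet_image.2 hs) fun n => ?_
      rw [← toAdd_ofAdd n, hpre, hsinv])
    (fun U hU => by
      have hle : W₀ ≤ U.map W₀.subtype := hleast (by
        rw [hμ] at hU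
        exact hU)
      refine eq_top_iff.2 fun w _ => ?_
      obtain ⟨v, hv, hvw⟩ := hle w.2
      rwa [← show v = w from Subtype.ext hvw])
  refine ⟨W₀, hinv, q, hsymm, hpos, fun n x y => hq (Multiplicative.ofAdd n) x y, R, hR, ?_⟩
  rw [← hsphere, hμ]
  congr 1
  ext w
  simp
end

section
/- Let r ≥ 1 and let χ_1, …, χ_l (l ≥ 1) be nonzero linear functionals on ℝ^r. Suppose there exists p ∈ ℝ^r with χ_j(p) > 0 for all j = 1, …, l. Then there exist an index i ∈ {1,…,l} and a vector p' ∈ ℝ^r such that χ_i(p') = 0 and χ_j(p') > 0 for every j such that χ_j is not a positive scalar multiple of χ_i. -/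
/-!
STATEMENT 13: Let r ≥ 1 and let χ_1, …, χ_l (l ≥ 1) be nonzero linear functionals on ℝ^r.
Suppose there exists p ∈ ℝ^r with χ_j(p) > 0 for all j.  Then there exist an index i and a
vector p' ∈ ℝ^r such that χ_i(p') = 0 and χ_j(p') > 0 for every j such that χ_j is not a
positive scalar multiple of χ_i.
-/

/-- Finitely many linear functionals over an infinite field are told apart by a single vector. -/
theorem Module.Dual.exists_forall_apply_ne_apply {ι K M : Type*} [Finite ι] [Field K] [Infinite K]
    [AddCommGroup M] [Module K M] (f : ι → Module.Dual K M) :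
    ∃ v, ∀ i j, f i ≠ f j → f i v ≠ f j v := by
  obtain ⟨v, hv⟩ := Module.Dual.exists_forall_ne_zero_of_forall_exists
    (fun q : {q : ι × ι // f q.1 ≠ f q.2} ↦ f q.1.1 - f q.1.2) fun q ↦ by
      by_contra! h
      exact q.2 (sub_eq_zero.mp (LinearMap.ext h))
  exact ⟨v, fun i j hij ↦ sub_ne_zero.mp (hv ⟨(i, j), hij⟩)⟩

theorem exists_facet_vector_of_positive_cone
    {r l : ℕ} (hr : 1 ≤ r) (hl : 1 ≤ l)
    (χ : Fin l → ((Fin r → ℝ) →ₗ[ℝ] ℝ))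
    (hχ : ∀ j, χ j ≠ 0)
    (hpos : ∃ p : Fin r → ℝ, ∀ j, 0 < χ j p) :
    ∃ (i : Fin l) (p' : Fin r → ℝ), χ i p' = 0 ∧
      ∀ j : Fin l, (¬ ∃ c : ℝ, 0 < c ∧ χ j = c • χ i) → 0 < χ j p' := by
  obtain ⟨p, hp⟩ := hpos
  -- Normalize the functionals to take the value `1` at `p`.
  obtain ⟨v, hv⟩ := Module.Dual.exists_forall_apply_ne_apply fun j ↦ (χ j p)⁻¹ • χ j
  have : Nonempty (Fin l) := ⟨⟨0, hl⟩⟩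
  obtain ⟨i, hi⟩ := Finite.exists_min fun j ↦ (χ j p)⁻¹ * χ j v
  refine ⟨i, v - ((χ i p)⁻¹ * χ i v) • p, ?_, fun j hj ↦ ?_⟩
  · have := (hp i).ne'
    simp only [map_sub, map_smul, smul_eq_mul]
    field_simp
    ring
  · have hne : (χ i p)⁻¹ • χ i ≠ (χ j p)⁻¹ • χ j := fun h ↦
      hj ⟨χ j p * (χ i p)⁻¹, mul_pos (hp j) (inv_pos.mpr (hp i)), by
        rw [mul_smul, h, smul_inv_smul₀ (hp j).ne']⟩
    have hlt : (χ i p)⁻¹ * χ i v < (χ j p)⁻¹ * χ j v := (hi j).lt_of_ne (hv i j hne)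
    rw [← div_eq_inv_mul (χ j v), lt_div_iff₀ (hp j)] at hlt
    simpa using hlt
end

section
/- Let A ∈ GL(d,ℚ) be an invertible d×d rational matrix whose characteristic polynomial is irreducible over ℚ, with complex eigenvalues ζ_1, …, ζ_d, and let m be a nonzero integer. If the powers ζ_1^m, …, ζ_d^m are pairwise distinct, then the characteristic polynomial of A^m is irreducible over ℚ. In particular, if no ratio ζ_i/ζ_j with i ≠ j is a root of unity, then the characteristic polynomial of A^m is irreducible over ℚ for every nonzero integer m. -/
/-!
STATEMENT 19: Let A ∈ GL(d,ℚ) have irreducible characteristic polynomial over ℚ with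
complex eigenvalues ζ_1, …, ζ_d, and let m be a nonzero integer.  If ζ_1^m, …, ζ_d^m are
pairwise distinct, then the characteristic polynomial of A^m is irreducible over ℚ.  In
particular, if no ratio ζ_i/ζ_j (i ≠ j) is a root of unity, then the characteristic
polynomial of A^m is irreducible over ℚ for every nonzero integer m.
-/

open Polynomial

/-- An element of a field embedding into `n × n` matrices is a primitive element as soon as its
images under `n` field embeddings are distinct; the characteristic polynomial of its matrix is then
irreducible. -/
theorem Matrix.charpoly_irreducible_of_injective_algHom {F K L n : Type*} [Field F] [Field K]
    [Field L] [Algebra F K] [Algebra F L] [Fintype n] [DecidableEq n] [Nonempty n]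
    (ψ : K →ₐ[F] Matrix n n F) (φ : n → K →ₐ[F] L) (y : K)
    (hy : Function.Injective fun i => φ i y) : Irreducible (ψ y).charpoly := by
  have hψ : Function.Injective ψ := ψ.toRingHom.injective
  have hq : aeval y (ψ y).charpoly = 0 := hψ <| by
    rw [← aeval_algHom_apply, Matrix.aeval_self_charpoly, map_zero]
  have hint : IsIntegral F y := ⟨_, (ψ y).charpoly_monic, hq⟩
  have hs0 : minpoly F y ≠ 0 := minpoly.ne_zero hint
  have hroot (i : n) : φ i y ∈ (minpoly F y).aroots L := by
    rw [mem_aroots]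
    exact ⟨hs0, by rw [aeval_algHom_apply, minpoly.aeval, map_zero]⟩
  have hcard : Fintype.card n ≤ (minpoly F y).natDegree := by
    classical
    calc Fintype.card n = (Finset.univ.image fun i => φ i y).card := by
          rw [Finset.card_image_of_injective _ hy, Finset.card_univ]
      _ ≤ ((minpoly F y).aroots L).toFinset.card := by
          refine Finset.card_le_card fun z hz => ?_
          obtain ⟨i, -, rfl⟩ := Finset.mem_image.1 hz
          exact Multiset.mem_toFinset.2 (hroot i)
      _ ≤ Multiset.card ((minpoly F y).aroots L) := Multiset.toFinset_card_le _
      _ ≤ ((minpoly F y).map (algebraMap F L)).natDegree := card_roots' _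
      _ = (minpoly F y).natDegree := natDegree_map _
  rw [eq_of_monic_of_dvd_of_natDegree_le (minpoly.monic hint) (ψ y).charpoly_monic
    (minpoly.dvd F y hq) (by rwa [Matrix.charpoly_natDegree_eq_dim])]
  exact minpoly.irreducible hint

theorem charpoly_pow_irreducible
    {d : ℕ} (A : (Matrix (Fin d) (Fin d) ℚ)ˣ)
    (hirr : Irreducible ((A : Matrix (Fin d) (Fin d) ℚ).charpoly))
    (ζ : Fin d → ℂ)
    (hζ : ((A : Matrix (Fin d) (Fin d) ℚ).map (Rat.cast : ℚ → ℂ)).charpoly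
        = ∏ i, (X - C (ζ i)))
    (m : ℤ) (hm : m ≠ 0) :
    (Function.Injective (fun i => ζ i ^ m) →
        Irreducible (((A ^ m : (Matrix (Fin d) (Fin d) ℚ)ˣ) : Matrix (Fin d) (Fin d) ℚ).charpoly)) ∧
      ((∀ i j : Fin d, i ≠ j → ∀ k : ℕ, k ≠ 0 → (ζ i / ζ j) ^ k ≠ 1) →
        ∀ m' : ℤ, m' ≠ 0 →
          Irreducible (((A ^ m' : (Matrix (Fin d) (Fin d) ℚ)ˣ) : Matrix (Fin d) (Fin d) ℚ).charpoly)) := by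
  have : Nonempty (Fin d) := by
    by_contra h
    rw [not_nonempty_iff] at h
    exact hirr.not_isUnit (by simp [Matrix.charpoly])
  set p := (A : Matrix (Fin d) (Fin d) ℚ).charpoly with hp
  have : Fact (Irreducible p) := ⟨hirr⟩
  let ψ : AdjoinRoot p →ₐ[ℚ] Matrix (Fin d) (Fin d) ℚ :=
    Ideal.Quotient.liftₐ (Ideal.span {p}) (aeval (A : Matrix (Fin d) (Fin d) ℚ)) fun q hq => by
      obtain ⟨r, rfl⟩ := Ideal.mem_span_singleton.1 hq
      rw [map_mul, hp, Matrix.aeval_self_charpoly, zero_mul]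
  have hψ : ψ (AdjoinRoot.root p) = A := aeval_X _
  have hroot (i : Fin d) : aeval (ζ i) p = 0 := by
    have hmap : p.map (algebraMap ℚ ℂ) = ∏ i, (X - C (ζ i)) := by
      rw [← hζ, hp, ← Matrix.charpoly_map]
      rfl
    rw [← eval_map_algebraMap, hmap, eval_prod]
    exact Finset.prod_eq_zero (Finset.mem_univ i) (by simp)
  let φ (i : Fin d) : AdjoinRoot p →ₐ[ℚ] ℂ :=
    AdjoinRoot.liftAlgHom p (Algebra.ofId _ _) (ζ i) (hroot i)
  have hφ (i : Fin d) : φ i (AdjoinRoot.root p) = ζ i := AdjoinRoot.liftAlgHom_root ..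
  have hx : AdjoinRoot.root p ≠ 0 := fun h => A.ne_zero (by rw [← hψ, h, map_zero])
  have hψm (k : ℤ) : ψ (AdjoinRoot.root p ^ k) = (A ^ k : (Matrix (Fin d) (Fin d) ℚ)ˣ) := by
    have hA : Units.map (ψ : AdjoinRoot p →* Matrix (Fin d) (Fin d) ℚ) (Units.mk0 _ hx) = A :=
      Units.ext hψ
    rw [← hA, ← map_zpow, Units.coe_map, Units.val_zpow_eq_zpow_val, Units.val_mk0]
    rfl
  have key (k : ℤ) (hk : Function.Injective fun i => ζ i ^ k) :
      Irreducible ((A ^ k : (Matrix (Fin d) (Fin d) ℚ)ˣ) : Matrix (Fin d) (Fin d) ℚ).charpoly := by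
    rw [← hψm]
    exact Matrix.charpoly_irreducible_of_injective_algHom ψ φ _ (by simpa only [map_zpow₀, hφ])
  refine ⟨key m, fun hratio k hk => key k fun i j hij => ?_⟩
  by_contra hne
  have hζj : ζ j ≠ 0 := by
    rw [← hφ]
    exact (_root_.map_ne_zero _).2 hx
  have hpow : (ζ i / ζ j) ^ k = 1 := by
    rw [div_zpow, div_eq_one_iff_eq (zpow_ne_zero _ hζj)]
    exact hij
  refine hratio i j hne k.natAbs (Int.natAbs_ne_zero.2 hk) ?_
  rcases Int.natAbs_eq k with h | h <;> rw [h] at hpow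
  · exact_mod_cast hpow
  · simpa only [zpow_neg, zpow_natCast, inv_eq_one] using hpow
end
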